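/- arXiv:2411.09445 — 2 statements merged into one kernel-verified Lean document; each statement's English description precedes it below -/
import Mathlib

section
/- For every positive integer n, g(n,7) ≤ 2^n/10; that is, there is a Q_7-hitting set in Q_n of size at most 2^n/10. -/
/-- `G` is a `Q_d`-hitting set in `Q_n`: it meets the vertex set `{Y ∪ A : A ⊆ X}`
of every copy of `Q_d` in `Q_n` (given by `X` of size `d` and `Y` disjoint from `X`). -/
def IsHitting (n d : ℕ) (G : Finset (Finset (Fin n))) : Prop :=
  ∀ X Y : Finset (Fin n), X.card = d → Disjoint X Y → ∃ A ⊆ X, Y ∪ A ∈ G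

/-- `g n d` is the minimum size of a `Q_d`-hitting set in `Q_n`. -/
noncomputable def g (n d : ℕ) : ℕ :=
  sInf {k | ∃ G : Finset (Finset (Fin n)), IsHitting n d G ∧ G.card = k}

/-- Over a field with four elements no `7` vectors extend `r - j` given ones to a basis of `K ^ r`
in all possible ways, when `2 ≤ j ≤ 5`. -/
theorem exists_not_linearIndepOn {ι K : Type*} [DecidableEq ι] [Field K] [Fintype K]
    (hK : Fintype.card K = 4) {X Y : Finset ι} (hX : X.card = 7) (hXY : Disjoint X Y)
    {j r : ℕ} (hj : 2 ≤ j) (hj' : j ≤ 5) (hr : r = Y.card + j) (v : ι → Fin r → K) :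
    ∃ A ⊆ X, A.card = j ∧ ¬ LinearIndepOn K v (Y ∪ A : Finset ι) := by
  classical
  by_contra! h
  obtain ⟨A, hAX, hA⟩ := Finset.exists_subset_card_eq (s := X) (n := j) (by omega)
  have hE : (X \ A).card = 7 - j := by rw [Finset.card_sdiff_of_subset hAX, hX, hA]
  have hYA : Disjoint Y A := (hXY.mono_left hAX).symm
  have hspan (x : ι) : ∃ c : ι → K, ∑ i ∈ Y ∪ A, c i • v i = v x := by
    have hli := h A hAX hA
    have htop : Submodule.span K (Set.range fun i : (Y ∪ A : Finset ι) ↦ v i) = ⊤ :=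
      LinearIndependent.span_eq_top_of_card_eq_finrank' hli (by
        simp [Finset.card_union_of_disjoint hYA, hA, hr])
    have hx : v x ∈ Submodule.span K (v '' (Y ∪ A : Finset ι)) := by
      rw [Set.image_eq_range]
      exact htop ▸ Submodule.mem_top
    exact (Submodule.mem_span_image_finset_iff_exists_fun' K).1 hx
  choose c hc using hspan
  have hnz {x e : ι} (hx : x ∈ X \ A) (he : e ∈ A) : c x e ≠ 0 := by
    intro h0
    rw [Finset.mem_sdiff] at hx
    have hli := h (insert x (A.erase e)) (by grind) (by
      rw [Finset.card_insert_of_notMem (by grind), Finset.card_erase_of_mem he]; omega)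
    have hset : Y ∪ insert x (A.erase e) = insert x ((Y ∪ A).erase e) := by
      ext i; have := Finset.disjoint_left.1 hYA; grind
    have hxY : x ∉ Y := Finset.disjoint_left.1 hXY hx.1
    rw [hset, Finset.coe_insert, linearIndepOn_insert (by simp; grind)] at hli
    refine hli.2 ?_
    rw [← hc x, ← Finset.add_sum_erase _ _ (Finset.mem_union_right Y he), h0, zero_smul, zero_add]
    exact Submodule.sum_mem _ fun i hi ↦
      Submodule.smul_mem _ _ (Submodule.subset_span ⟨i, hi, rfl⟩)
  have hminor {x x' e e' : ι} (hx : x ∈ X \ A) (hx' : x' ∈ X \ A) (hxx : x ≠ x') (he : e ∈ A)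
      (he' : e' ∈ A) (hee : e ≠ e') (μ : K) (h1 : c x e = μ * c x' e)
      (h2 : c x e' = μ * c x' e') : False := by
    rw [Finset.mem_sdiff] at hx hx'
    have hxY : x ∉ Y := Finset.disjoint_left.1 hXY hx.1
    have hxY' : x' ∉ Y := Finset.disjoint_left.1 hXY hx'.1
    have he1 : e' ∈ A.erase e := Finset.mem_erase.2 ⟨hee.symm, he'⟩
    have hli := h (insert x (insert x' ((A.erase e).erase e'))) (by grind) (by
      rw [Finset.card_insert_of_notMem (by grind), Finset.card_insert_of_notMem (by grind),
        Finset.card_erase_of_mem he1, Finset.card_erase_of_mem he]; omega)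
    have hset : Y ∪ insert x (insert x' ((A.erase e).erase e')) =
        insert x (insert x' (((Y ∪ A).erase e).erase e')) := by
      ext i; have := Finset.disjoint_left.1 hYA; grind
    rw [hset, Finset.coe_insert, linearIndepOn_insert (by simp; grind)] at hli
    refine hli.2 ?_
    have hcomb : v x = μ • v x' +
        ∑ i ∈ ((Y ∪ A).erase e).erase e', (c x i - μ * c x' i) • v i := by
      rw [Finset.sum_erase _ (by simp [h2]), Finset.sum_erase _ (by simp [h1])]
      simp_rw [sub_smul, mul_smul, Finset.sum_sub_distrib, ← Finset.smul_sum, hc]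
      abel
    rw [hcomb]
    refine Submodule.add_mem _ (Submodule.smul_mem _ _ (Submodule.subset_span ⟨x', by simp, rfl⟩))
      (Submodule.sum_mem _ fun i hi ↦
        Submodule.smul_mem _ _ (Submodule.subset_span ⟨i, ?_, rfl⟩))
    exact Finset.mem_coe.2 (Finset.mem_insert_of_mem hi)
  have hK0 : ((Finset.univ : Finset K).erase 0).card = 3 := by
    rw [Finset.card_erase_of_mem (Finset.mem_univ _), Finset.card_univ, hK]
  rcases Nat.lt_or_ge j 4 with hj4 | hj4
  · obtain ⟨e, he, e', he', hee⟩ := Finset.one_lt_card.1 (show 1 < A.card by omega)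
    obtain ⟨x, hx, x', hx', hxx, hq⟩ := Finset.exists_ne_map_eq_of_card_lt_of_maps_to
      (s := X \ A) (t := Finset.univ.erase 0) (f := fun x ↦ c x e / c x e') (by omega)
      (fun x hx ↦ by simpa using ⟨hnz hx he, hnz hx he'⟩)
    have := hnz hx he'
    have := hnz hx' he'
    refine hminor hx hx' hxx he he' hee (c x e' / c x' e') ?_ (by field_simp)
    field_simp at hq ⊢
    linear_combination hq
  · obtain ⟨x, hx, x', hx', hxx⟩ := Finset.one_lt_card.1 (show 1 < (X \ A).card by omega)
    obtain ⟨e, he, e', he', hee, hq⟩ := Finset.exists_ne_map_eq_of_card_lt_of_maps_to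
      (s := A) (t := Finset.univ.erase 0) (f := fun e ↦ c x e / c x' e) (by omega)
      (fun e he ↦ by simpa using ⟨hnz hx he, hnz hx' he⟩)
    have := hnz hx' he
    have := hnz hx' he'
    refine hminor hx hx' hxx he he' hee (c x e / c x' e) (by field_simp) ?_
    have hq : c x e / c x' e = c x e' / c x' e' := hq
    rw [hq]
    field_simp

theorem two_mul_le_three_mul_prod (r : ℕ) :
    2 * (4 ^ r) ^ r ≤ 3 * ∏ i : Fin r, (4 ^ r - 4 ^ (i : ℕ)) := by
  have key (k : ℕ) (hk : k ≤ r) : (4 ^ r : ℤ) ^ k * (3 * 4 ^ r + 1 - 4 ^ k) ≤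
      3 * 4 ^ r * ∏ i ∈ Finset.range k, (4 ^ r - 4 ^ i : ℤ) := by
    induction k with
    | zero => simp
    | succ k ih =>
      have hN : (4 : ℤ) ^ k ≤ 4 ^ r := pow_le_pow_right₀ (by norm_num) (by omega)
      have h1 : (1 : ℤ) ≤ 4 ^ k := one_le_pow₀ (by norm_num)
      rw [Finset.prod_range_succ, ← mul_assoc]
      refine le_trans ?_ (mul_le_mul_of_nonneg_right (ih (by omega)) (sub_nonneg.2 hN))
      rw [pow_succ _ k, mul_assoc, mul_assoc, pow_succ 4 k]
      refine mul_le_mul_of_nonneg_left ?_ (by positivity)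
      nlinarith
  have hr := key r le_rfl
  have hpos : (0 : ℤ) < 4 ^ r := by positivity
  have h : 2 * (4 ^ r : ℤ) ^ r ≤ 3 * ∏ i ∈ Finset.range r, (4 ^ r - 4 ^ i : ℤ) := by
    refine le_of_mul_le_mul_left ?_ hpos
    nlinarith [pow_pos hpos r]
  rw [Fin.prod_univ_eq_prod_range (fun i ↦ 4 ^ r - 4 ^ i)]
  zify
  rw [Finset.prod_congr rfl fun i hi ↦ Nat.cast_sub
    (pow_le_pow_right₀ (by norm_num) (Finset.mem_range.1 hi).le)]
  exact_mod_cast h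

theorem card_linearIndepOn {ι K V : Type*} [DecidableEq ι] [Field K] [AddCommGroup V] [Module K V]
    {r : ℕ} {S : Finset ι} (hS : S.card = r) :
    Nat.card {v : ι → V // LinearIndepOn K v S} =
      Nat.card {w : Fin r → V // LinearIndependent K w} * Nat.card ({i // i ∉ S} → V) := by
  let e : (ι → V) ≃ (S → V) × ({i // i ∉ S} → V) :=
    Equiv.piEquivPiSubtypeProd (· ∈ S) (fun _ ↦ V)
  have e1 : {v : ι → V // LinearIndepOn K v S} ≃
      {w : S → V // LinearIndependent K w} × ({i // i ∉ S} → V) :=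
    (e.subtypeEquiv (q := fun p : (S → V) × ({i // i ∉ S} → V) ↦ LinearIndependent K p.1)
      fun v ↦ Iff.rfl).trans
        (Equiv.prodSubtypeFstEquivSubtypeProd (α := S → V) (β := {i // i ∉ S} → V)
          (p := fun w ↦ LinearIndependent K w))
  have e2 : {w : S → V // LinearIndependent K w} ≃ {w : Fin r → V // LinearIndependent K w} :=
    ((S.equivFinOfCardEq hS).arrowCongr (Equiv.refl _)).subtypeEquiv fun w ↦
      (linearIndependent_equiv (S.equivFinOfCardEq hS).symm).symm
  rw [← Nat.card_prod]
  exact Nat.card_congr (e1.trans (e2.prodCongr (Equiv.refl _)))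

theorem three_mul_card_not_linearIndepOn_le {ι K : Type*} [Fintype ι] [DecidableEq ι] [Field K]
    [Fintype K] (hK : Fintype.card K = 4) {r : ℕ} {S : Finset ι} (hS : S.card = r) :
    3 * Nat.card {v : ι → Fin r → K // ¬ LinearIndepOn K v S} ≤ Nat.card (ι → Fin r → K) := by
  classical
  have h1 := card_linearIndepOn (K := K) (V := Fin r → K) hS
  have h2 : Nat.card (ι → Fin r → K) = (4 ^ r) ^ r * Nat.card ({i // i ∉ S} → Fin r → K) := by
    rw [Nat.card_congr (Equiv.piEquivPiSubtypeProd (· ∈ S) fun _ ↦ Fin r → K), Nat.card_prod]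
    simp [hK, hS]
  have h3 : Nat.card {v : ι → Fin r → K // LinearIndepOn K v S} +
      Nat.card {v : ι → Fin r → K // ¬ LinearIndepOn K v S} = Nat.card (ι → Fin r → K) := by
    rw [← Nat.card_sum]
    exact Nat.card_congr (Equiv.sumCompl _)
  rw [card_linearIndependent (by simp), hK, Module.finrank_fin_fun] at h1
  have h4 := Nat.mul_le_mul_right (Nat.card ({i // i ∉ S} → Fin r → K))
    (two_mul_le_three_mul_prod r)
  rw [mul_assoc, mul_assoc, ← h1, ← h2] at h4
  omega

theorem exists_three_mul_card_filter_le (ι K : Type*) [Fintype ι] [DecidableEq ι] [Field K]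
    [Fintype K] (hK : Fintype.card K = 4) (r : ℕ) : ∃ v : ι → Fin r → K, ∀ 𝒜 : Finset (Finset ι),
      (∀ S ∈ 𝒜, S.card = r ∧ ¬ LinearIndepOn K v S) →
        3 * 𝒜.card ≤ (Fintype.card ι).choose r := by
  classical
  have hsum : ∑ v : ι → Fin r → K,
      3 * ((Finset.univ.powersetCard r).filter fun S : Finset ι ↦ ¬ LinearIndepOn K v S).card ≤
      ∑ _v : ι → Fin r → K, (Fintype.card ι).choose r := by
    rw [← Finset.mul_sum]
    refine (congrArg (3 * ·) (Finset.sum_card_bipartiteAbove_eq_sum_card_bipartiteBelow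
      fun (v : ι → Fin r → K) (S : Finset ι) ↦ ¬ LinearIndepOn K v S)).trans_le ?_
    rw [Finset.mul_sum]
    calc _ ≤ ∑ S ∈ Finset.univ.powersetCard r, Nat.card (ι → Fin r → K) := by
          refine Finset.sum_le_sum fun S hS ↦ ?_
          refine le_trans (le_of_eq ?_)
            (three_mul_card_not_linearIndepOn_le hK (Finset.mem_powersetCard.1 hS).2)
          rw [Nat.card_eq_fintype_card, Fintype.card_subtype]
          rfl
      _ = _ := by
          rw [Finset.sum_const, Finset.sum_const, Finset.card_powersetCard, Finset.card_univ,
            Finset.card_univ, Nat.card_eq_fintype_card, smul_eq_mul, smul_eq_mul, mul_comm]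
  obtain ⟨v, -, hv⟩ := Finset.exists_le_of_sum_le Finset.univ_nonempty hsum
  refine ⟨v, fun 𝒜 h𝒜 ↦ le_trans (Nat.mul_le_mul_left 3 (Finset.card_le_card fun S hS ↦ ?_)) hv⟩
  simpa using h𝒜 S hS

theorem exists_four_mul_card_filter_mod_le (n : ℕ) :
    ∃ t < 4, 4 * (Finset.univ.filter fun S : Finset (Fin n) ↦ S.card % 4 = t).card ≤ 2 ^ n := by
  by_contra! h
  have hs := Finset.card_eq_sum_card_fiberwise (f := fun S : Finset (Fin n) ↦ S.card % 4)
    (s := Finset.univ) (t := Finset.range 4) (fun S _ ↦ by simp [Nat.mod_lt])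
  simp only [Finset.sum_range_succ, Finset.sum_range_zero, Finset.card_univ, Fintype.card_finset,
    Fintype.card_fin] at hs
  have := h 0 (by norm_num)
  have := h 1 (by norm_num)
  have := h 2 (by norm_num)
  have := h 3 (by norm_num)
  omega

theorem exists_isHitting_seven (n : ℕ) :
    ∃ G : Finset (Finset (Fin n)), IsHitting n 7 G ∧ 12 * G.card ≤ 2 ^ n := by
  classical
  have hK : Nat.card (GaloisField 2 2) = 4 := GaloisField.card 2 2 two_ne_zero
  have : Finite (GaloisField 2 2) := Nat.finite_of_card_ne_zero (by omega)
  have : Fintype (GaloisField 2 2) := Fintype.ofFinite _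
  rw [Nat.card_eq_fintype_card] at hK
  choose v hv using exists_three_mul_card_filter_le (Fin n) (GaloisField 2 2) hK
  obtain ⟨t, ht, hcard⟩ := exists_four_mul_card_filter_mod_le n
  set L := Finset.univ.filter fun S : Finset (Fin n) ↦ S.card % 4 = t with hL
  set G := L.filter fun S : Finset (Fin n) ↦
    ¬ LinearIndepOn (GaloisField 2 2) (v S.card) (S : Set (Fin n)) with hG
  refine ⟨G, fun X Y hX hXY ↦ ?_, ?_⟩
  · obtain ⟨j, hj, hj', hjt⟩ : ∃ j, 2 ≤ j ∧ j ≤ 5 ∧ (Y.card + j) % 4 = t :=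
      ⟨2 + (t + 4 - (Y.card + 2) % 4) % 4, by omega, by omega, by omega⟩
    obtain ⟨A, hAX, hA, hdep⟩ := exists_not_linearIndepOn hK hX hXY hj hj' rfl (v (Y.card + j))
    have hYA : (Y ∪ A).card = Y.card + j := by
      rw [Finset.card_union_of_disjoint (hXY.mono_left hAX).symm, hA]
    refine ⟨A, hAX, ?_⟩
    rw [hG, hL, Finset.mem_filter, Finset.mem_filter, hYA]
    exact ⟨⟨Finset.mem_univ _, hjt⟩, hdep⟩
  · have h3 : 3 * G.card ≤ L.card := by
      rw [← Finset.sum_card_slice G, ← Finset.sum_card_slice L, Finset.mul_sum]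
      refine Finset.sum_le_sum fun r _ ↦ ?_
      by_cases hr : r % 4 = t
      · have hLr : L.slice r = Finset.univ.powersetCard r := by
          ext S; simp [Finset.mem_slice, hL]; grind
        rw [hLr, Finset.card_powersetCard, Finset.card_univ]
        refine hv r _ fun S hS ↦ ?_
        rw [Finset.mem_slice, hG, Finset.mem_filter] at hS
        exact ⟨hS.2, hS.2 ▸ hS.1.2⟩
      · have hGr : G.slice r = ∅ := by
          ext S; simp [Finset.mem_slice, hG, hL]; grind
        simp [hGr]
    omega

/-- For every positive integer `n`, `g(n,7) ≤ 2^n / 10`: there is a `Q_7`-hitting set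
in `Q_n` of size at most `2^n / 10`. -/
theorem g_n_seven_le (n : ℕ) (hn : 0 < n) :
    (g n 7 : ℝ) ≤ 2 ^ n / 10 ∧
    ∃ G : Finset (Finset (Fin n)), IsHitting n 7 G ∧ (G.card : ℝ) ≤ 2 ^ n / 10 := by
  obtain ⟨G, hG, hcard⟩ := exists_isHitting_seven n
  have hle : (G.card : ℝ) ≤ 2 ^ n / 10 := by
    have h : (12 * G.card : ℝ) ≤ 2 ^ n := by exact_mod_cast hcard
    have : (0 : ℝ) ≤ G.card := Nat.cast_nonneg _
    linarith
  have hg : g n 7 ≤ G.card := Nat.sInf_le ⟨G, hG, rfl⟩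
  exact ⟨le_trans (by exact_mod_cast hg) hle, G, hG, hle⟩
end

section
/- Let v_1, v_2, …, v_7 be seven vectors in F_5^3, the 3-dimensional vector space over the field with 5 elements. Then there exist three pairwise distinct indices i, j, k ∈ {1,…,7} such that v_i, v_j, v_k do not form a basis of F_5^3 (equivalently, v_i, v_j, v_k are linearly dependent). -/
/-- The determinant of the matrix with rows `x, y, z`. -/
def tripleDet {R : Type*} [CommRing R] (x y z : Fin 3 → R) : R :=
  (Matrix.of ![x, y, z]).det

theorem tripleDet_ne_zero_of_linearIndependent {K : Type*} [Field K] {x y z : Fin 3 → K}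
    (h : LinearIndependent K ![x, y, z]) : tripleDet x y z ≠ 0 :=
  ((Matrix.isUnit_iff_isUnit_det _).1 (Matrix.linearIndependent_rows_iff_isUnit.1 h)).ne_zero

/-- A Plücker relation between the minors of five vectors, two of which are shared. -/
theorem tripleDet_mul_sub_mul {R : Type*} [CommRing R] (x y z u w : Fin 3 → R) :
    tripleDet x y u * tripleDet x z w - tripleDet x y w * tripleDet x z u =
      tripleDet x y z * tripleDet x u w := by
  simp only [tripleDet, Matrix.det_fin_three, Matrix.of_apply, Matrix.cons_val]
  ring

/-- Wilson's theorem modulo 5, for an arbitrary enumeration of the units. -/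
theorem prod_eq_neg_one_of_injective (f : Fin 4 → ZMod 5) (hf : Function.Injective f)
    (h0 : ∀ i, f i ≠ 0) : ∏ i, f i = -1 := by
  have key : ∀ a : ZMod 5, a ≠ 0 → ∀ b, b ≠ 0 → a ≠ b → ∀ c, c ≠ 0 → a ≠ c → b ≠ c →
      ∀ d, d ≠ 0 → a ≠ d → b ≠ d → c ≠ d → a * b * c * d = -1 := by decide
  rw [Fin.prod_univ_four]
  apply key <;> first | exact h0 _ | exact hf.ne (by decide)

/-- Four nonzero pairs with pairwise distinct ratios exhaust the nonzero ratios in `F_5`. -/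
theorem prod_eq_neg_prod_of_ratio_injective (f g : Fin 4 → ZMod 5) (hf : ∀ i, f i ≠ 0)
    (hg : ∀ i, g i ≠ 0) (h : ∀ i j, i ≠ j → f i * g j - f j * g i ≠ 0) :
    ∏ i, f i = -∏ i, g i := by
  have : Fact (Nat.Prime 5) := ⟨by norm_num⟩
  have hprod := prod_eq_neg_one_of_injective (fun i ↦ f i / g i) (fun i j hij ↦ by
    by_contra hne
    exact h i j hne (sub_eq_zero.2 ((div_eq_div_iff (hg i) (hg j)).1 hij)))
    (fun i ↦ div_ne_zero (hf i) (hg i))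
  rw [Finset.prod_div_distrib, div_eq_iff (Finset.prod_ne_zero_iff.2 fun i _ ↦ hg i)] at hprod
  rw [hprod, neg_one_mul]

/-- For `x, y, z, w 0, …, w 3` in general position, the products of the minors
`det (x, y, w i)` and `det (x, z, w i)` are opposite. -/
theorem prod_tripleDet_eq_neg_prod_tripleDet (x y z : Fin 3 → ZMod 5) (w : Fin 4 → Fin 3 → ZMod 5)
    (hxyz : tripleDet x y z ≠ 0) (hy : ∀ i, tripleDet x y (w i) ≠ 0)
    (hz : ∀ i, tripleDet x z (w i) ≠ 0) (hw : ∀ i j, i ≠ j → tripleDet x (w i) (w j) ≠ 0) :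
    ∏ i, tripleDet x y (w i) = -∏ i, tripleDet x z (w i) := by
  have : Fact (Nat.Prime 5) := ⟨by norm_num⟩
  refine prod_eq_neg_prod_of_ratio_injective _ _ hy hz fun i j hij ↦ ?_
  rw [tripleDet_mul_sub_mul]
  exact mul_ne_zero hxyz (hw i j hij)

theorem tripleDet_swap_first_two {R : Type*} [CommRing R] (x y z : Fin 3 → R) :
    tripleDet x y z = -tripleDet y x z := by
  simp only [tripleDet, Matrix.det_fin_three, Matrix.of_apply, Matrix.cons_val]
  ring

/-- Among any seven vectors in `F_5^3`, some three of them (with pairwise distinct indices)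
do not form a basis, i.e. are linearly dependent. -/
theorem seven_vectors_F5_cubed (v : Fin 7 → Fin 3 → ZMod 5) :
    ∃ i j k : Fin 7, i ≠ j ∧ i ≠ k ∧ j ≠ k ∧
      ¬ LinearIndependent (ZMod 5) ![v i, v j, v k] := by
  by_contra! hv
  have hzero : ∀ t : ZMod 5, t = -t → t = 0 := by decide
  have : Fact (Nat.Prime 5) := ⟨by norm_num⟩
  have hdet (i j k : Fin 7) (hij : i ≠ j) (hik : i ≠ k) (hjk : j ≠ k) :
      tripleDet (v i) (v j) (v k) ≠ 0 :=
    tripleDet_ne_zero_of_linearIndependent (hv i j k hij hik hjk)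
  let w (i : Fin 4) : Fin 3 → ZMod 5 := v (i.natAdd 3)
  have opposite (a b c : Fin 7) (hab : a ≠ b) (hac : a ≠ c) (hbc : b ≠ c)
      (ha : a < 3) (hb : b < 3) (hc : c < 3) :
      ∏ i, tripleDet (v a) (v b) (w i) = -∏ i, tripleDet (v a) (v c) (w i) := by
    have hne (d : Fin 7) (hd : d < 3) (i : Fin 4) : d ≠ i.natAdd 3 := by
      revert d i; decide
    exact prod_tripleDet_eq_neg_prod_tripleDet _ _ _ w (hdet a b c hab hac hbc)
      (fun i ↦ hdet _ _ _ hab (hne a ha i) (hne b hb i))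
      (fun i ↦ hdet _ _ _ hac (hne a ha i) (hne c hc i))
      (fun i j hij ↦ hdet _ _ _ (hne a ha i) (hne a ha j)
        ((Fin.natAdd_injective 4 3).ne hij))
  have swap (a b : Fin 7) :
      ∏ i, tripleDet (v a) (v b) (w i) = ∏ i, tripleDet (v b) (v a) (w i) := by
    simp_rw [tripleDet_swap_first_two (v a) (v b), Finset.prod_neg]
    rw [Finset.card_univ, Fintype.card_fin, Even.neg_one_pow (by decide), one_mul]
  have h0 := opposite 0 1 2 (by decide) (by decide) (by decide) (by decide) (by decide) (by decide)
  have h1 := opposite 1 2 0 (by decide) (by decide) (by decide) (by decide) (by decide) (by decide)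
  have h2 := opposite 2 0 1 (by decide) (by decide) (by decide) (by decide) (by decide) (by decide)
  rw [swap 1 0] at h1
  rw [swap 2 0, swap 2 1] at h2
  have hself : ∏ i, tripleDet (v 0) (v 1) (w i) = -∏ i, tripleDet (v 0) (v 1) (w i) := by
    linear_combination h0 + h1 - h2
  refine Finset.prod_ne_zero_iff.2 (fun i _ ↦ ?_) (hzero _ hself)
  exact hdet 0 1 _ (by decide) (by revert i; decide) (by revert i; decide)
end
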